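/- Let n ≥ 4 be an integer and let (a,b,c) be a triple of positive integers with 1 ≤ a ≤ b ≤ c ≤ ⌊n/2⌋. If a + b = c, then A_{n,(a,b,c)}^{(c)} ≤ sin²(πc/n)·(1 + cos²(πc/n)/4). If a + b + c = n, then A_{n,(a,b,c)}^{(c)} ≤ sin²(πc/n)·(1 + cos²(πc/n)/2). -/

import Mathlib

/-- `N_{(a,b,c)}`: the number of distinct ordered triples obtained by permuting `(a,b,c)`. -/
def Ntriple (p : ℕ × ℕ × ℕ) : ℕ :=
  ({(p.1, p.2.1, p.2.2), (p.1, p.2.2, p.2.1), (p.2.1, p.1, p.2.2),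
    (p.2.1, p.2.2, p.1), (p.2.2, p.1, p.2.1), (p.2.2, p.2.1, p.1)} : Finset (ℕ × ℕ × ℕ)).card

/-- The weight `θ_{n,(a,b,c)} = N_{(a,b,c)}/3`. -/
noncomputable def thetaTri (p : ℕ × ℕ × ℕ) : ℝ := (Ntriple p : ℝ) / 3

/-- `w_{n,(a,b,c)} = sin²(πa/n) + sin²(πb/n) + sin²(πc/n)`. -/
noncomputable def wTri (n : ℕ) (p : ℕ × ℕ × ℕ) : ℝ :=
  Real.sin (Real.pi * p.1 / n) ^ 2 + Real.sin (Real.pi * p.2.1 / n) ^ 2 +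
    Real.sin (Real.pi * p.2.2 / n) ^ 2

/-- `A_{n,(a,b,c)}^{(c)} = w²/(4(sin²(πa/n)+sin²(πb/n)))`. -/
noncomputable def AcTri (n : ℕ) (p : ℕ × ℕ × ℕ) : ℝ :=
  wTri n p ^ 2 / (4 * (Real.sin (Real.pi * p.1 / n) ^ 2 + Real.sin (Real.pi * p.2.1 / n) ^ 2))

/-- `A_{n,(a,b,c)}^{(b)} = w²/(4(sin²(πa/n)+sin²(πc/n)))`. -/
noncomputable def AbTri (n : ℕ) (p : ℕ × ℕ × ℕ) : ℝ :=
  wTri n p ^ 2 / (4 * (Real.sin (Real.pi * p.1 / n) ^ 2 + Real.sin (Real.pi * p.2.2 / n) ^ 2))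

/-- The index set `E_n`: triples `1 ≤ a ≤ b ≤ c ≤ ⌊n/2⌋` with `a+b = c` or `a+b+c = n`.
For odd `n = 2m+1` this is `E_n^{(1)} ∪ E_n^{(2)}`, and for even `n = 2m` it is
`E_n^{(1)} ∪ E_n^{(2)} ∪ E_n^{(3)}` (triples of `E_n^{(2)}` with `c = m` satisfy `a+b = m = c`
and hence coincide with `E_n^{(3)}`). -/
def Etri (n : ℕ) : Finset (ℕ × ℕ × ℕ) :=
  (Finset.range (n / 2 + 1) ×ˢ Finset.range (n / 2 + 1) ×ˢ Finset.range (n / 2 + 1)).filter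
    fun p => 1 ≤ p.1 ∧ p.1 ≤ p.2.1 ∧ p.2.1 ≤ p.2.2 ∧
      (p.1 + p.2.1 = p.2.2 ∨ p.1 + p.2.1 + p.2.2 = n)

/-- `Q_{n,3}(x) = (1/n³)·∑_{(a,b,c)∈E_n} θ_{n,(a,b,c)}·w_{n,(a,b,c)}·x_a·x_b·x_c`. -/
noncomputable def Q3 (n : ℕ) (x : ℕ → ℝ) : ℝ :=
  (1 / (n : ℝ) ^ 3) * ∑ p ∈ Etri n, thetaTri p * wTri n p * x p.1 * x p.2.1 * x p.2.2

/-- `Q_{n,2}`: for odd `n = 2m+1`, `(2/n²)·∑_{k=1}^{m}(k−1)·sin²(πk/n)·x_k²`; for even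
`n = 2m`, `(2/n²)·∑_{k=1}^{m−1}(k−1)·sin²(πk/n)·x_k² + ((m−1)/n²)·x_m²`. -/
noncomputable def Q2 (n : ℕ) (x : ℕ → ℝ) : ℝ :=
  if n % 2 = 1 then
    (2 / (n : ℝ) ^ 2) * ∑ k ∈ Finset.Icc 1 (n / 2),
      ((k : ℝ) - 1) * Real.sin (Real.pi * k / n) ^ 2 * x k ^ 2
  else
    (2 / (n : ℝ) ^ 2) * ∑ k ∈ Finset.Icc 1 (n / 2 - 1),
      ((k : ℝ) - 1) * Real.sin (Real.pi * k / n) ^ 2 * x k ^ 2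
    + (((n / 2 : ℕ) : ℝ) - 1) / (n : ℝ) ^ 2 * x (n / 2) ^ 2

/-- `Q_{n,4}`: for odd `n = 2m+1`, `(2/n⁴)(∑_{k=1}^m x_k²)(∑_{k=1}^m sin²(πk/n)x_k²)`; for
even `n = 2m`, `(2/n⁴)(∑_{k=1}^{m−1} x_k² + x_m²/2)(∑_{k=1}^{m−1} sin²(πk/n)x_k² + x_m²/2)`. -/
noncomputable def Q4 (n : ℕ) (x : ℕ → ℝ) : ℝ :=
  if n % 2 = 1 then
    (2 / (n : ℝ) ^ 4) * (∑ k ∈ Finset.Icc 1 (n / 2), x k ^ 2) *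
      (∑ k ∈ Finset.Icc 1 (n / 2), Real.sin (Real.pi * k / n) ^ 2 * x k ^ 2)
  else
    (2 / (n : ℝ) ^ 4) * ((∑ k ∈ Finset.Icc 1 (n / 2 - 1), x k ^ 2) + x (n / 2) ^ 2 / 2) *
      ((∑ k ∈ Finset.Icc 1 (n / 2 - 1), Real.sin (Real.pi * k / n) ^ 2 * x k ^ 2)
        + x (n / 2) ^ 2 / 2)

theorem ac_sin_sq_sum (x y : ℝ) : Real.sin x ^ 2 + Real.sin y ^ 2 =
    1 - Real.cos (x + y) * Real.cos (x - y) := by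
  rw [Real.cos_add, Real.cos_sub]
  have h1 := Real.sin_sq_add_cos_sq x
  have h2 := Real.sin_sq_add_cos_sq y
  have e1 : Real.cos x ^ 2 = 1 - Real.sin x ^ 2 := by linarith
  have e2 : Real.cos y ^ 2 = 1 - Real.sin y ^ 2 := by linarith
  have : (Real.cos x * Real.cos y - Real.sin x * Real.sin y) *
      (Real.cos x * Real.cos y + Real.sin x * Real.sin y) =
      Real.cos x ^ 2 * Real.cos y ^ 2 - Real.sin x ^ 2 * Real.sin y ^ 2 := by ring
  rw [this, e1, e2]
  ring

theorem ac_one (x y : ℝ) (hx : 0 < Real.sin x) (hy : 0 < Real.sin y)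
    (hC : 0 ≤ Real.cos (x + y)) :
    (Real.sin x ^ 2 + Real.sin y ^ 2 + Real.sin (x + y) ^ 2) ^ 2 /
      (4 * (Real.sin x ^ 2 + Real.sin y ^ 2)) ≤
    Real.sin (x + y) ^ 2 * (1 + Real.cos (x + y) ^ 2 / 4) := by
  have hu : 0 < Real.sin x ^ 2 + Real.sin y ^ 2 := by positivity
  have hDC : 0 ≤ Real.cos (x - y) - Real.cos (x + y) := by
    rw [Real.cos_add, Real.cos_sub]
    nlinarith [mul_pos hx hy]
  have hD := Real.cos_le_one (x - y)
  have hC1 := Real.cos_le_one (x + y)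
  have hS : Real.sin (x + y) ^ 2 = 1 - Real.cos (x + y) ^ 2 := Real.sin_sq _
  rw [div_le_iff₀ (by positivity), hS, ac_sin_sq_sum]
  generalize Real.cos (x + y) = C at *
  generalize Real.cos (x - y) = D at *
  have k1 : D - C ≤ 1 - C ^ 2 := by nlinarith
  have k2 : D - C ≤ 1 - C * D := by nlinarith
  have k3 : (D - C) * (D - C) ≤ (1 - C ^ 2) * (1 - C * D) :=
    mul_le_mul k1 k2 hDC (by linarith)
  nlinarith [mul_le_mul_of_nonneg_left k3 (sq_nonneg C)]

theorem ac_two (x y z : ℝ) (hz : x + y + z = Real.pi)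
    (hx : 0 < Real.sin x) (hy : 0 < Real.sin y)
    (hC : 0 ≤ Real.cos z) (hC2 : Real.cos z ≤ 1 / 2) :
    (Real.sin x ^ 2 + Real.sin y ^ 2 + Real.sin z ^ 2) ^ 2 /
      (4 * (Real.sin x ^ 2 + Real.sin y ^ 2)) ≤
    Real.sin z ^ 2 * (1 + Real.cos z ^ 2 / 2) := by
  have hu : 0 < Real.sin x ^ 2 + Real.sin y ^ 2 := by positivity
  have hcz : Real.cos (x + y) = - Real.cos z := by
    rw [show x + y = Real.pi - z by linarith, Real.cos_pi_sub]
  have hDC : 0 ≤ Real.cos (x - y) + Real.cos z := by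
    have : Real.cos z = - Real.cos (x + y) := by linarith
    rw [this, Real.cos_add, Real.cos_sub]
    nlinarith [mul_pos hx hy]
  have hD := Real.cos_le_one (x - y)
  have hS : Real.sin z ^ 2 = 1 - Real.cos z ^ 2 := Real.sin_sq _
  rw [div_le_iff₀ (by positivity), hS, ac_sin_sq_sum, hcz]
  clear hcz
  generalize Real.cos z = C at *
  generalize Real.cos (x - y) = D at *
  have k1 : D + C ≤ 2 * (1 - C ^ 2) := by nlinarith
  have k2 : D + C ≤ 1 + C * D := by nlinarith
  have k3 : (D + C) * (D + C) ≤ (2 * (1 - C ^ 2)) * (1 + C * D) :=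
    mul_le_mul k1 k2 hDC (by linarith)
  nlinarith [mul_le_mul_of_nonneg_left k3 (sq_nonneg C)]

/-- Upper bounds for `A_{n,(a,b,c)}^{(c)}` (Lemma 4.4): for `n ≥ 4` and
`1 ≤ a ≤ b ≤ c ≤ ⌊n/2⌋`, if `a+b = c` then
`A^{(c)} ≤ sin²(πc/n)(1 + cos²(πc/n)/4)`, and if `a+b+c = n` then
`A^{(c)} ≤ sin²(πc/n)(1 + cos²(πc/n)/2)`. -/
theorem AcTri_upper_bound (n a b c : ℕ) (hn : 4 ≤ n) (ha : 1 ≤ a) (hab : a ≤ b)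
    (hbc : b ≤ c) (hc : c ≤ n / 2) :
    (a + b = c →
      AcTri n (a, b, c) ≤
        Real.sin (Real.pi * c / n) ^ 2 * (1 + Real.cos (Real.pi * c / n) ^ 2 / 4)) ∧
    (a + b + c = n →
      AcTri n (a, b, c) ≤
        Real.sin (Real.pi * c / n) ^ 2 * (1 + Real.cos (Real.pi * c / n) ^ 2 / 2)) := by
  have hpi := Real.pi_pos
  have hnR : (0 : ℝ) < n := by exact_mod_cast (by omega : 0 < n)
  have hpos : ∀ k : ℕ, 1 ≤ k → k < n → 0 < Real.sin (Real.pi * k / n) := by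
    intro k hk hkn
    have hk' : (0 : ℝ) < k := by exact_mod_cast hk
    have hkn' : (k : ℝ) < n := by exact_mod_cast hkn
    apply Real.sin_pos_of_pos_of_lt_pi (by positivity)
    rw [div_lt_iff₀ hnR]
    nlinarith
  have hsa := hpos a ha (by omega)
  have hsb := hpos b (by omega) (by omega)
  have hc2 : 2 * (c : ℝ) ≤ n := by exact_mod_cast (by omega : 2 * c ≤ n)
  have hch : Real.pi * c / n ≤ Real.pi / 2 := by
    rw [div_le_iff₀ hnR]
    nlinarith
  have hc0 : 0 ≤ Real.pi * c / n := by positivity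
  have hcos : 0 ≤ Real.cos (Real.pi * c / n) :=
    Real.cos_nonneg_of_neg_pi_div_two_le_of_le (by linarith) hch
  constructor
  · intro h
    have e : Real.pi * c / n = Real.pi * a / n + Real.pi * b / n := by
      rw [← h]
      push_cast
      ring
    simp only [AcTri, wTri]
    rw [e] at hcos ⊢
    exact ac_one _ _ hsa hsb hcos
  · intro h
    have e : Real.pi * a / n + Real.pi * b / n + Real.pi * c / n = Real.pi := by
      have : (a : ℝ) + b + c = n := by exact_mod_cast h
      field_simp
      linarith
    have hc3 : (n : ℝ) ≤ 3 * c := by exact_mod_cast (by omega : n ≤ 3 * c)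
    have h3 : Real.pi / 3 ≤ Real.pi * c / n := by
      rw [le_div_iff₀ hnR]
      nlinarith
    have hc4 : Real.cos (Real.pi * c / n) ≤ 1 / 2 := by
      rw [← Real.cos_pi_div_three]
      exact Real.cos_le_cos_of_nonneg_of_le_pi (by positivity) (by linarith) h3
    simp only [AcTri, wTri]
    exact ac_two _ _ _ e hsa hsb hcos hc4
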